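/- arXiv:2001.11306 — 3 statements merged into one kernel-verified Lean document; each statement's English description precedes it below -/
import Mathlib

section
/- Let 0 < p < 1/2. There exists a Borel measure μ on ℝ with support equal to ℝ and μ([-1/2, 1/2)) = 1 such that for every k ∈ ℤ and j ∈ ℤ, writing Q = [(j-1/2)·3^{-k}, (j+1/2)·3^{-k}), the central triadic child [(3j-1/2)·3^{-k-1}, (3j+1/2)·3^{-k-1}) satisfies μ(central child) = (1-2p)·μ(Q) and each of the other two triadic children of Q satisfies μ(child) = p·μ(Q). Moreover, if additionally 0 < p ≤ 1/3, then every such measure μ satisfies dim_A μ = −log p / log 3. -/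
open Metric MeasureTheory Set
open scoped ENNReal

noncomputable section

/-- `coverNumber x R r` : the minimal number of closed `r`-balls needed to cover the closed
ball `B(x,R)` (`⊤` if no finite family of closed `r`-balls covers it). -/
noncomputable def coverNumber {X : Type*} [MetricSpace X] (x : X) (R r : ℝ) : ℕ∞ :=
  sInf {n : ℕ∞ | ∃ s : Finset X, (s.card : ℕ∞) = n ∧
    Metric.closedBall x R ⊆ ⋃ y ∈ s, Metric.closedBall y r}

/-- The Assouad dimension of a metric space `X`: the infimum of those `α ≥ 0` for which there
is a constant `0 < C < ∞` with `N(x,R,r) ≤ C (R/r)^α` for all `x ∈ X` and `0 < r < R < ∞`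
(`⊤` if no such `α` exists). -/
noncomputable def assouadDim (X : Type*) [MetricSpace X] : ℝ≥0∞ :=
  sInf {d : ℝ≥0∞ | ∃ α : ℝ, 0 ≤ α ∧ d = ENNReal.ofReal α ∧ ∃ C : ℝ, 0 < C ∧
    ∀ x : X, ∀ r R : ℝ, 0 < r → r < R →
      (coverNumber x R r : ℝ≥0∞) ≤ ENNReal.ofReal (C * (R / r) ^ α)}

/-- The Assouad dimension of a measure `μ` on a metric space `X`: the infimum of those `α ≥ 0`
for which there is a constant `0 < C < ∞` with `μ(B(x,R))/μ(B(x,r)) ≤ C (R/r)^α` for all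
`x ∈ X` and `0 < r < R < ∞` (`⊤` if no such `α` exists). -/
noncomputable def measureAssouadDim {X : Type*} [MetricSpace X] [MeasurableSpace X]
    (μ : Measure X) : ℝ≥0∞ :=
  sInf {d : ℝ≥0∞ | ∃ α : ℝ, 0 ≤ α ∧ d = ENNReal.ofReal α ∧ ∃ C : ℝ, 0 < C ∧
    ∀ x : X, ∀ r R : ℝ, 0 < r → r < R →
      μ (Metric.closedBall x R) / μ (Metric.closedBall x r) ≤
        ENNReal.ofReal (C * (R / r) ^ α)}

/-- The lower dimension of a metric space `X`: the supremum of those `α ≥ 0` for which there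
is a constant `0 < C < ∞` with `N(x,R,r) ≥ C (R/r)^α` for all `x ∈ X` and
`0 < r < R < diam X`. -/
noncomputable def lowerDim (X : Type*) [MetricSpace X] : ℝ≥0∞ :=
  sSup {d : ℝ≥0∞ | ∃ α : ℝ, 0 ≤ α ∧ d = ENNReal.ofReal α ∧ ∃ C : ℝ, 0 < C ∧
    ∀ x : X, ∀ r R : ℝ, 0 < r → r < R →
      ENNReal.ofReal R < EMetric.diam (Set.univ : Set X) →
      ENNReal.ofReal (C * (R / r) ^ α) ≤ (coverNumber x R r : ℝ≥0∞)}

/-- The lower dimension of a measure `μ` on a metric space `X`: the supremum of those `α ≥ 0`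
for which there is a constant `0 < C < ∞` with `μ(B(x,R))/μ(B(x,r)) ≥ C (R/r)^α` for all
`x ∈ X` and `0 < r < R < diam X`. -/
noncomputable def measureLowerDim {X : Type*} [MetricSpace X] [MeasurableSpace X]
    (μ : Measure X) : ℝ≥0∞ :=
  sSup {d : ℝ≥0∞ | ∃ α : ℝ, 0 ≤ α ∧ d = ENNReal.ofReal α ∧ ∃ C : ℝ, 0 < C ∧
    ∀ x : X, ∀ r R : ℝ, 0 < r → r < R →
      ENNReal.ofReal R < EMetric.diam (Set.univ : Set X) →
      ENNReal.ofReal (C * (R / r) ^ α) ≤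
        μ (Metric.closedBall x R) / μ (Metric.closedBall x r)}

/-- A measure has full support (`spt μ = X`) iff every nonempty open set has positive measure. -/
def HasFullSupport {X : Type*} [MetricSpace X] [MeasurableSpace X] (μ : Measure X) : Prop :=
  ∀ U : Set X, IsOpen U → U.Nonempty → 0 < μ U

/-- A `δ`-adic cube system on a metric space `X`: countable collections `cubes k` (`k ∈ ℤ`) of
Borel sets, each cube `Q` of generation `k` carrying a center `center k Q`, satisfying the
properties (i)–(v) of Theorem 2.1 of Käenmäki–Rajala–Suomala. -/
structure CubeSystem (X : Type*) [MetricSpace X] [MeasurableSpace X] (δ : ℝ) where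
  cubes : ℤ → Set (Set X)
  center : ℤ → Set X → X
  countable : ∀ k : ℤ, (cubes k).Countable
  borel : ∀ k : ℤ, ∀ Q ∈ cubes k, MeasurableSet Q
  covers : ∀ k : ℤ, ⋃₀ cubes k = Set.univ
  nested : ∀ ⦃k k' : ℤ⦄, k ≤ k' → ∀ ⦃Q : Set X⦄, Q ∈ cubes k → ∀ ⦃Q' : Set X⦄,
    Q' ∈ cubes k' → (Q ∩ Q').Nonempty → Q' ⊆ Q
  ball_subset : ∀ k : ℤ, ∀ Q ∈ cubes k, Metric.closedBall (center k Q) (δ ^ k / 3) ⊆ Q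
  subset_ball : ∀ k : ℤ, ∀ Q ∈ cubes k, Q ⊆ Metric.closedBall (center k Q) (2 * δ ^ k)
  origin : ∃ x₀ : X, ∀ k : ℤ, x₀ ∈ center k '' cubes k
  centers_nested : ∀ k : ℤ, center k '' cubes k ⊆ center (k + 1) '' cubes (k + 1)

namespace CubeSystem

variable {X : Type*} [MetricSpace X] [MeasurableSpace X] {δ : ℝ}

/-- The children of a cube `Q` of generation `k`: the cubes of generation `k+1` contained
in `Q`. -/
def children (S : CubeSystem X δ) (k : ℤ) (Q : Set X) : Set (Set X) :=
  {Q' ∈ S.cubes (k + 1) | Q' ⊆ Q}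

/-- `M_Q`, the number of children of a cube `Q` of generation `k` (as an extended natural). -/
noncomputable def childCount (S : CubeSystem X δ) (k : ℤ) (Q : Set X) : ℕ∞ :=
  (S.children k Q).encard

/-- `M = sup_Q M_Q`, the supremum of the numbers of children over all cubes. -/
noncomputable def maxChildCount (S : CubeSystem X δ) : ℕ∞ :=
  ⨆ k : ℤ, ⨆ Q ∈ S.cubes k, S.childCount k Q

/-- `Q'` is the central child of the cube `Q` of generation `k`: it is a child of `Q` whose
center coincides with that of `Q`. -/
def IsCentralChild (S : CubeSystem X δ) (k : ℤ) (Q Q' : Set X) : Prop :=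
  Q' ∈ S.children k Q ∧ S.center (k + 1) Q' = S.center k Q

/-- `Q'` is a boundary child of the cube `Q` of generation `k`: a child which is not central. -/
def IsBoundaryChild (S : CubeSystem X δ) (k : ℤ) (Q Q' : Set X) : Prop :=
  Q' ∈ S.children k Q ∧ S.center (k + 1) Q' ≠ S.center k Q

/-- The `m`-th generation offspring of a cube `Q` of generation `k`: the cubes `Q' ≺_m Q`,
i.e. `Q' ∈ cubes (k+m)` with `Q' ⊆ Q`. -/
def descendants (S : CubeSystem X δ) (k : ℤ) (Q : Set X) (m : ℕ) : Set (Set X) :=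
  {Q' ∈ S.cubes (k + m) | Q' ⊆ Q}

/-- A measure `μ` adapted to the parameter `p`: a fully supported measure such that each
boundary child inherits `p` times the mass of its parent, while the central child inherits
`1 - (M_Q - 1)p` times the mass of its parent. -/
def Adapted (S : CubeSystem X δ) (p : ℝ) (μ : Measure X) : Prop :=
  HasFullSupport μ ∧
  ∀ k : ℤ, ∀ Q ∈ S.cubes k, ∀ Q' ∈ S.children k Q,
    (S.IsBoundaryChild k Q Q' → μ Q' = ENNReal.ofReal p * μ Q) ∧
    (S.IsCentralChild k Q Q' →
      μ Q' = ENNReal.ofReal (1 - (((S.children k Q).ncard : ℝ) - 1) * p) * μ Q)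

/-- `c 0 ≻ c 1 ≻ ... ≻ c N` is a chain of cubes starting at generation `k`: `c 0` is a cube of
generation `k` and each `c (i+1)` is a child of `c i`. -/
def IsChain (S : CubeSystem X δ) (k : ℤ) (N : ℕ) (c : ℕ → Set X) : Prop :=
  c 0 ∈ S.cubes k ∧ ∀ i : ℕ, i < N → c (i + 1) ∈ S.children (k + i) (c i)

/-- The number of boundary cubes among `c 1, ..., c N` in a chain starting at generation `k`. -/
noncomputable def boundaryCount (S : CubeSystem X δ) (k : ℤ) (N : ℕ) (c : ℕ → Set X) : ℕ :=
  {i : ℕ | i < N ∧ S.IsBoundaryChild (k + i) (c i) (c (i + 1))}.ncard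

end CubeSystem

end

/-- The triadic interval `[(j - 1/2)·3^{-k}, (j + 1/2)·3^{-k})` of generation `k ∈ ℤ` and
index `j ∈ ℤ`. Its central child is `triadic (k+1) (3j)` and its boundary children are
`triadic (k+1) (3j-1)` and `triadic (k+1) (3j+1)`. -/
def triadic (k j : ℤ) : Set ℝ :=
  Set.Ico (((j : ℝ) - 1 / 2) * (3 : ℝ) ^ (-k)) (((j : ℝ) + 1 / 2) * (3 : ℝ) ^ (-k))

open Filter Topology

/-- The relative mass of the `j`-th triadic interval of a fixed generation, normalised to be `1` at
`j = 0`: a power of `ρ` counting the nonzero balanced ternary digits of `j`. -/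
noncomputable def triadicWeight (ρ : ℝ) (j : ℤ) : ℝ :=
  if j = 0 then 1 else (if j % 3 = 0 then 1 else ρ) * triadicWeight ρ ((j + 1) / 3)
termination_by j.natAbs
decreasing_by omega

section Weight

variable (ρ : ℝ)

lemma triadicWeight_zero : triadicWeight ρ 0 = 1 := by
  rw [triadicWeight]; simp

lemma triadicWeight_three_mul (j : ℤ) : triadicWeight ρ (3 * j) = triadicWeight ρ j := by
  by_cases hj : j = 0
  · simp [hj]
  · rw [triadicWeight, if_neg (by omega), if_pos (by omega), one_mul]
    congr 1; omega

lemma triadicWeight_three_mul_add_one (j : ℤ) :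
    triadicWeight ρ (3 * j + 1) = ρ * triadicWeight ρ j := by
  rw [triadicWeight, if_neg (by omega), if_neg (by omega)]
  congr 2; omega

lemma triadicWeight_three_mul_sub_one (j : ℤ) :
    triadicWeight ρ (3 * j - 1) = ρ * triadicWeight ρ j := by
  rw [triadicWeight, if_neg (by omega), if_neg (by omega)]
  congr 2; omega

/-- Induction on integers along the tree of balanced ternary expansions. -/
lemma balancedTernary_induction {P : ℤ → Prop} (zero : P 0) (mid : ∀ j, P j → P (3 * j))
    (right : ∀ j, P j → P (3 * j + 1)) (left : ∀ j, P j → P (3 * j - 1)) (j : ℤ) : P j := by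
  induction h : j.natAbs using Nat.strong_induction_on generalizing j with
  | _ n ih =>
    subst h
    by_cases hj : j = 0
    · exact hj ▸ zero
    have hp : P ((j + 1) / 3) := ih _ (by omega) _ rfl
    obtain h | h | h : j = 3 * ((j + 1) / 3) ∨ j = 3 * ((j + 1) / 3) + 1 ∨
        j = 3 * ((j + 1) / 3) - 1 := by omega
    · exact h ▸ mid _ hp
    · exact h ▸ right _ hp
    · exact h ▸ left _ hp

variable {ρ}

lemma triadicWeight_pos (hρ : 0 < ρ) (j : ℤ) : 0 < triadicWeight ρ j := by
  induction j using balancedTernary_induction with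
  | zero => simp [triadicWeight_zero]
  | mid j h => rwa [triadicWeight_three_mul]
  | right j h => rw [triadicWeight_three_mul_add_one]; positivity
  | left j h => rw [triadicWeight_three_mul_sub_one]; positivity

/-- Neighbouring triadic intervals have comparable masses. -/
lemma triadicWeight_neighbor (hρ : 0 < ρ) (hρ1 : ρ ≤ 1) (j : ℤ) :
    ρ * triadicWeight ρ (j + 1) ≤ triadicWeight ρ j ∧
      ρ * triadicWeight ρ (j - 1) ≤ triadicWeight ρ j := by
  have hpos := triadicWeight_pos hρ
  have hm (j : ℤ) : ρ * (ρ * triadicWeight ρ j) ≤ triadicWeight ρ j := by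
    nlinarith [mul_le_mul hρ1 hρ1 hρ.le zero_le_one, hpos j]
  induction j using balancedTernary_induction with
  | zero =>
    have h1 := triadicWeight_three_mul_add_one ρ 0
    have h2 := triadicWeight_three_mul_sub_one ρ 0
    have := hm 0
    norm_num at h1 h2 ⊢
    rw [h1, h2]
    exact ⟨this, this⟩
  | mid j h =>
    rw [triadicWeight_three_mul_add_one, triadicWeight_three_mul_sub_one, triadicWeight_three_mul]
    exact ⟨hm j, hm j⟩
  | right j h =>
    rw [show 3 * j + 1 + 1 = 3 * (j + 1) - 1 by ring, show 3 * j + 1 - 1 = 3 * j by ring,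
      triadicWeight_three_mul_add_one, triadicWeight_three_mul_sub_one, triadicWeight_three_mul]
    exact ⟨mul_le_mul_of_nonneg_left h.1 hρ.le, le_rfl⟩
  | left j h =>
    rw [show 3 * j - 1 - 1 = 3 * (j - 1) + 1 by ring, show 3 * j - 1 + 1 = 3 * j by ring,
      triadicWeight_three_mul_add_one, triadicWeight_three_mul_sub_one, triadicWeight_three_mul]
    exact ⟨le_rfl, mul_le_mul_of_nonneg_left h.2 hρ.le⟩

end Weight

/-- The cumulative sums of `triadicWeight`, normalised so as to be odd about `-1/2`. -/
noncomputable def triadicSum (ρ : ℝ) (j : ℤ) : ℝ :=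
  1 / 2 + ∑ i ∈ Finset.Ioc 0 j, triadicWeight ρ i - ∑ i ∈ Finset.Ioc j 0, triadicWeight ρ i

lemma triadicSum_zero (ρ : ℝ) : triadicSum ρ 0 = 1 / 2 := by simp [triadicSum]

lemma triadicSum_add_one (ρ : ℝ) (j : ℤ) :
    triadicSum ρ (j + 1) = triadicSum ρ j + triadicWeight ρ (j + 1) := by
  unfold triadicSum
  rcases le_or_gt 0 j with h | h
  · have h1 : Finset.Ioc 0 (j + 1) = insert (j + 1) (Finset.Ioc 0 j) := by
      ext; simp only [Finset.mem_Ioc, Finset.mem_insert]; omega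
    rw [h1, Finset.sum_insert (by simp), Finset.Ioc_eq_empty (a := j + 1) (by omega),
      Finset.Ioc_eq_empty (a := j) (by omega)]
    ring
  · have h1 : Finset.Ioc j 0 = insert (j + 1) (Finset.Ioc (j + 1) 0) := by
      ext; simp only [Finset.mem_Ioc, Finset.mem_insert]; omega
    rw [h1, Finset.sum_insert (by simp), Finset.Ioc_eq_empty (b := j + 1) (by omega),
      Finset.Ioc_eq_empty (b := j) (by omega)]
    ring

lemma triadicSum_mono {ρ : ℝ} (hρ : 0 < ρ) : Monotone (triadicSum ρ) :=
  monotone_int_of_le_succ fun j => by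
    rw [triadicSum_add_one]
    linarith [triadicWeight_pos hρ (j + 1)]

lemma triadicSum_three_mul_add_one (ρ : ℝ) (j : ℤ) :
    triadicSum ρ (3 * j + 1) = (1 + 2 * ρ) * triadicSum ρ j := by
  have step (j : ℤ) : triadicSum ρ (3 * (j + 1) + 1) =
      triadicSum ρ (3 * j + 1) + (1 + 2 * ρ) * triadicWeight ρ (j + 1) := by
    rw [triadicSum_add_one, triadicWeight_three_mul_add_one,
      show 3 * (j + 1) = 3 * j + 1 + 1 + 1 by ring, triadicSum_add_one, triadicSum_add_one,
      show 3 * j + 1 + 1 = 3 * (j + 1) - 1 by ring, triadicWeight_three_mul_sub_one,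
      show 3 * (j + 1) - 1 + 1 = 3 * (j + 1) by ring, triadicWeight_three_mul]
    ring
  induction j using Int.induction_on with
  | zero =>
    have h := triadicSum_add_one ρ 0
    have h1 := triadicWeight_three_mul_add_one ρ 0
    norm_num [triadicSum_zero, triadicWeight_zero] at h h1 ⊢
    rw [h, h1]; ring
  | succ j ih => rw [step, ih, triadicSum_add_one]; ring
  | pred j ih =>
    have h := step (-j - 1)
    have h1 := triadicSum_add_one ρ (-j - 1)
    rw [show (-j - 1 + 1 : ℤ) = -j by ring] at h h1
    linear_combination ih - h + (1 + 2 * ρ) * h1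

/-- The right endpoint of `triadic k j`. -/
noncomputable def triadicEnd (k j : ℤ) : ℝ := ((j : ℝ) + 1 / 2) * (3 : ℝ) ^ (-k)

lemma triadic_eq_Ico (k j : ℤ) : triadic k j = Ico (triadicEnd k (j - 1)) (triadicEnd k j) := by
  unfold triadic triadicEnd
  congr 2
  push_cast; ring

lemma triadicEnd_iterate (k j : ℤ) (m : ℕ) :
    triadicEnd (k + m) ((fun i => 3 * i + 1)^[m] j) = triadicEnd k j := by
  induction m with
  | zero => simp
  | succ m ih =>
    rw [← ih, Function.iterate_succ_apply']
    unfold triadicEnd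
    have : (3 : ℝ) ^ (-(k + (m : ℤ))) = 3 * 3 ^ (-(k + ((m + 1 : ℕ) : ℤ))) := by
      rw [← zpow_one_add₀ (by norm_num)]; congr 1; push_cast; ring
    rw [this]; push_cast; ring

lemma triadicEnd_sub_one (k j : ℤ) : triadicEnd k (j - 1) = triadicEnd k j - 3 ^ (-k) := by
  unfold triadicEnd; push_cast; ring

lemma triadicEnd_le_iff (k i j : ℤ) : triadicEnd k i ≤ triadicEnd k j ↔ i ≤ j := by
  unfold triadicEnd
  rw [mul_le_mul_iff_left₀ (by positivity)]
  simp

lemma exists_mem_triadic (k : ℤ) (x : ℝ) : ∃ j, x ∈ triadic k j := by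
  have h3 : (0 : ℝ) < 3 ^ (-k) := by positivity
  refine ⟨⌊x / 3 ^ (-k) + 1 / 2⌋, ?_, ?_⟩
  · rw [← le_div_iff₀ h3]
    linarith [Int.floor_le (x / (3 : ℝ) ^ (-k) + 1 / 2)]
  · rw [← div_lt_iff₀ h3]
    linarith [Int.lt_floor_add_one (x / (3 : ℝ) ^ (-k) + 1 / 2)]

lemma triadic_succ_subset {k i j : ℤ} (h₁ : 3 * j - 1 ≤ i) (h₂ : i ≤ 3 * j + 1) :
    triadic (k + 1) i ⊆ triadic k j := by
  have e (j : ℤ) := triadicEnd_iterate k j 1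
  simp only [Nat.cast_one, Function.iterate_one] at e
  rw [triadic_eq_Ico, triadic_eq_Ico, ← e, ← e]
  exact Ico_subset_Ico ((triadicEnd_le_iff ..).2 (by omega)) ((triadicEnd_le_iff ..).2 (by omega))

lemma triadic_subset_closedBall {k j : ℤ} {x r : ℝ} (hx : x ∈ triadic k j)
    (hr : (3 : ℝ) ^ (-k) ≤ r) : triadic k j ⊆ closedBall x r := by
  intro y hy
  rw [Real.closedBall_eq_Icc]
  obtain ⟨h1, h2⟩ := hx
  obtain ⟨h3, h4⟩ := hy
  constructor <;> nlinarith

lemma closedBall_subset_triadic {k j : ℤ} {x r : ℝ} (hx : x ∈ triadic k j)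
    (hr : r < (3 : ℝ) ^ (-k)) :
    closedBall x r ⊆ triadic k (j - 1) ∪ triadic k j ∪ triadic k (j + 1) := by
  intro y hy
  rw [Real.closedBall_eq_Icc] at hy
  have h0 := triadicEnd_sub_one k (j - 1)
  have h1 := triadicEnd_sub_one k (j + 1)
  simp only [triadic_eq_Ico, mem_union, mem_Ico, add_sub_cancel_right] at hx h0 h1 ⊢
  obtain ⟨h3, h4⟩ := hy
  rcases lt_or_ge y (triadicEnd k (j - 1)) with h | h
  · exact Or.inl (Or.inl ⟨by linarith, h⟩)
  rcases lt_or_ge y (triadicEnd k j) with h' | h'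
  · exact Or.inl (Or.inr ⟨h, h'⟩)
  · exact Or.inr ⟨h', by linarith⟩

/-- A measure charging all triadic intervals has full support. -/
lemma hasFullSupport_of_triadic {μ : Measure ℝ} (h : ∀ k j, 0 < μ (triadic k j)) :
    HasFullSupport μ := by
  rintro U hU ⟨x, hx⟩
  obtain ⟨ε, hε, hb⟩ := nhds_basis_closedBall.mem_iff.1 (hU.mem_nhds hx)
  obtain ⟨n, hn, -⟩ := exists_mem_Ico_zpow hε (by norm_num : (1 : ℝ) < 3)
  obtain ⟨j, hj⟩ := exists_mem_triadic (-n) x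
  exact (h _ _).trans_le (measure_mono ((triadic_subset_closedBall hj (by simpa using hn)).trans hb))

section Construction

/-- The value of the distribution function at `triadicEnd k j`. -/
noncomputable def triadicValue (p : ℝ) (k j : ℤ) : ℝ :=
  (1 - 2 * p) ^ k * triadicSum (p / (1 - 2 * p)) j

/-- A monotone function interpolating the values `triadicValue` at triadic endpoints. -/
noncomputable def triadicCDF (p x : ℝ) : ℝ :=
  sInf {v | ∃ k j, x ≤ triadicEnd k j ∧ v = triadicValue p k j}


variable {p : ℝ}

lemma triadicValue_iterate (hp1 : p < 1 / 2) (k j : ℤ) (m : ℕ) :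
    triadicValue p (k + m) ((fun i => 3 * i + 1)^[m] j) = triadicValue p k j := by
  induction m with
  | zero => simp
  | succ m ih =>
    have hq : 1 - 2 * p ≠ 0 := by linarith
    rw [← ih, Function.iterate_succ_apply']
    unfold triadicValue
    rw [triadicSum_three_mul_add_one, Nat.cast_succ, ← add_assoc, zpow_add_one₀ hq]
    field_simp
    ring

lemma triadicValue_sub (k j : ℤ) : triadicValue p k j - triadicValue p k (j - 1) =
    (1 - 2 * p) ^ k * triadicWeight (p / (1 - 2 * p)) j := by
  have := triadicSum_add_one (p / (1 - 2 * p)) (j - 1)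
  rw [sub_add_cancel] at this
  rw [triadicValue, triadicValue, this]; ring

lemma triadicValue_mono (hp0 : 0 < p) (hp1 : p < 1 / 2) {k j k' j' : ℤ}
    (h : triadicEnd k j ≤ triadicEnd k' j') : triadicValue p k j ≤ triadicValue p k' j' := by
  have hq : 0 < 1 - 2 * p := by linarith
  obtain ⟨m, m', hm⟩ : ∃ m m' : ℕ, k + m = k' + m' :=
    ⟨(max k k' - k).toNat, (max k k' - k').toNat, by omega⟩
  rw [← triadicEnd_iterate k j m, ← triadicEnd_iterate k' j' m', hm, triadicEnd_le_iff] at h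
  rw [← triadicValue_iterate hp1 k j m, ← triadicValue_iterate hp1 k' j' m', hm]
  exact mul_le_mul_of_nonneg_left (triadicSum_mono (by positivity) h) (by positivity)

lemma triadicCDF_set_nonempty (x : ℝ) :
    {v | ∃ k j, x ≤ triadicEnd k j ∧ v = triadicValue p k j}.Nonempty := by
  obtain ⟨j, hj⟩ := exists_mem_triadic 0 x
  exact ⟨_, 0, j, hj.2.le, rfl⟩

lemma triadicCDF_set_bddBelow (hp0 : 0 < p) (hp1 : p < 1 / 2) (x : ℝ) :
    BddBelow {v | ∃ k j, x ≤ triadicEnd k j ∧ v = triadicValue p k j} := by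
  obtain ⟨j, hj⟩ := exists_mem_triadic 0 x
  rw [triadic_eq_Ico] at hj
  refine ⟨triadicValue p 0 (j - 1), ?_⟩
  rintro _ ⟨k, i, h, rfl⟩
  exact triadicValue_mono hp0 hp1 (hj.1.trans h)

lemma triadicCDF_mono (hp0 : 0 < p) (hp1 : p < 1 / 2) : Monotone (triadicCDF p) :=
  fun x y hxy => csInf_le_csInf (triadicCDF_set_bddBelow hp0 hp1 x) (triadicCDF_set_nonempty y)
    fun _ ⟨k, j, h, hv⟩ => ⟨k, j, hxy.trans h, hv⟩

lemma triadicCDF_triadicEnd (hp0 : 0 < p) (hp1 : p < 1 / 2) (k j : ℤ) :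
    triadicCDF p (triadicEnd k j) = triadicValue p k j := by
  refine le_antisymm (csInf_le (triadicCDF_set_bddBelow hp0 hp1 _) ⟨k, j, le_rfl, rfl⟩) ?_
  refine le_csInf (triadicCDF_set_nonempty _) ?_
  rintro _ ⟨k', j', h, rfl⟩
  exact triadicValue_mono hp0 hp1 h

/-- The Stieltjes function of the triadic measure with parameter `p`. -/
noncomputable def triadicStieltjes (hp0 : 0 < p) (hp1 : p < 1 / 2) : StieltjesFunction ℝ :=
  (triadicCDF_mono hp0 hp1).stieltjesFunction

lemma leftLim_triadicStieltjes (hp0 : 0 < p) (hp1 : p < 1 / 2) (k j : ℤ) :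
    Function.leftLim (triadicStieltjes hp0 hp1) (triadicEnd k j) = triadicValue p k j := by
  have hF := triadicCDF_mono hp0 hp1
  have hG := (triadicStieltjes hp0 hp1).mono
  apply le_antisymm
  · refine le_of_tendsto (hG.tendsto_leftLim _) ?_
    filter_upwards [self_mem_nhdsWithin] with x hx
    rw [← triadicCDF_triadicEnd hp0 hp1]
    exact hF.rightLim_le hx
  · have hq : 0 < 1 - 2 * p := by linarith
    set J : ℕ → ℤ := fun m => (fun i => 3 * i + 1)^[m] j with hJ
    have hw (m : ℕ) : (1 - 2 * p) ^ (k + m) * triadicWeight (p / (1 - 2 * p)) (J m) =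
        p ^ m * ((1 - 2 * p) ^ k * triadicWeight (p / (1 - 2 * p)) j) := by
      induction m with
      | zero => simp [hJ]
      | succ m ih =>
        have : J (m + 1) = 3 * J m + 1 := Function.iterate_succ_apply' ..
        rw [this, triadicWeight_three_mul_add_one, Nat.cast_succ, ← add_assoc,
          zpow_add_one₀ hq.ne', pow_succ']
        rw [mul_assoc p, ← ih]
        field_simp
    have hlim : Tendsto (fun m : ℕ => triadicValue p k j -
        p ^ m * ((1 - 2 * p) ^ k * triadicWeight (p / (1 - 2 * p)) j)) atTop
        (𝓝 (triadicValue p k j)) := by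
      simpa using tendsto_const_nhds.sub
        ((tendsto_pow_atTop_nhds_zero_of_lt_one hp0.le (by linarith)).mul_const _)
    refine le_of_tendsto' hlim fun m => ?_
    have hlt : triadicEnd (k + m) (J m - 1) < triadicEnd k j := by
      rw [← triadicEnd_iterate k j m, triadicEnd_sub_one]
      exact sub_lt_self _ (by positivity)
    rw [← hw, ← triadicValue_sub, triadicValue_iterate hp1, sub_sub_cancel,
      ← triadicCDF_triadicEnd hp0 hp1]
    exact (hF.le_rightLim le_rfl).trans (hG.le_leftLim hlt)

lemma triadicStieltjes_measure_triadic (hp0 : 0 < p) (hp1 : p < 1 / 2) (k j : ℤ) :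
    (triadicStieltjes hp0 hp1).measure (triadic k j) =
      ENNReal.ofReal ((1 - 2 * p) ^ k * triadicWeight (p / (1 - 2 * p)) j) := by
  rw [triadic_eq_Ico, StieltjesFunction.measure_Ico, leftLim_triadicStieltjes,
    leftLim_triadicStieltjes, triadicValue_sub]

end Construction

lemma triadic_zero_zero : triadic 0 0 = Ico (-(1 / 2) : ℝ) (1 / 2) := by
  norm_num [triadic]

section Uniqueness

variable {p : ℝ} {μ : Measure ℝ}

/-- The defining relations of a triadic measure determine its mass on triadic intervals. -/
lemma measure_triadic_eq (hp0 : 0 < p) (hp1 : p < 1 / 2)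
    (h1 : μ (Ico (-(1 / 2) : ℝ) (1 / 2)) = 1)
    (h : ∀ k j : ℤ,
        μ (triadic (k + 1) (3 * j)) = ENNReal.ofReal (1 - 2 * p) * μ (triadic k j) ∧
        μ (triadic (k + 1) (3 * j - 1)) = ENNReal.ofReal p * μ (triadic k j) ∧
        μ (triadic (k + 1) (3 * j + 1)) = ENNReal.ofReal p * μ (triadic k j)) (k j : ℤ) :
    μ (triadic k j) = ENNReal.ofReal ((1 - 2 * p) ^ k * triadicWeight (p / (1 - 2 * p)) j) := by
  have hq : 0 < 1 - 2 * p := by linarith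
  induction j using balancedTernary_induction generalizing k with
  | zero =>
    rw [triadicWeight_zero, mul_one]
    induction k using Int.induction_on with
    | zero => rw [triadic_zero_zero, h1, zpow_zero, ENNReal.ofReal_one]
    | succ k ih =>
      have := (h k 0).1
      rw [mul_zero] at this
      rw [this, ih, ← ENNReal.ofReal_mul hq.le, zpow_add_one₀ hq.ne', mul_comm]
    | pred k ih =>
      have := (h (-k - 1) 0).1
      rw [mul_zero, sub_add_cancel, ih] at this
      rw [zpow_sub_one₀ hq.ne', ← div_eq_mul_inv, ENNReal.ofReal_div_of_pos hq, this,
        mul_comm, ENNReal.mul_div_cancel_right (by simpa using hq) ENNReal.ofReal_ne_top]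
  | mid j ih =>
    have := (h (k - 1) j).1
    rw [sub_add_cancel, ih, ← ENNReal.ofReal_mul hq.le] at this
    rw [this, triadicWeight_three_mul, zpow_sub_one₀ hq.ne']
    congr 1; field_simp
  | right j ih =>
    have := (h (k - 1) j).2.2
    rw [sub_add_cancel, ih, ← ENNReal.ofReal_mul hp0.le] at this
    rw [this, triadicWeight_three_mul_add_one, zpow_sub_one₀ hq.ne']
    congr 1; field_simp
  | left j ih =>
    have := (h (k - 1) j).2.1
    rw [sub_add_cancel, ih, ← ENNReal.ofReal_mul hp0.le] at this
    rw [this, triadicWeight_three_mul_sub_one, zpow_sub_one₀ hq.ne']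
    congr 1; field_simp

end Uniqueness

section Dimension

variable {p : ℝ} {μ : Measure ℝ}

/-- The triadic interval containing a given one, `N` generations up, is at most `p ^ (-N)` times
heavier. -/
lemma exists_triadic_ancestor (hp0 : 0 < p) (hp : p ≤ 1 / 3) (k j : ℤ) (N : ℕ) :
    ∃ i, triadic k j ⊆ triadic (k - N) i ∧
      p ^ N * ((1 - 2 * p) ^ (k - N) * triadicWeight (p / (1 - 2 * p)) i) ≤
        (1 - 2 * p) ^ k * triadicWeight (p / (1 - 2 * p)) j := by
  have hq : 0 < 1 - 2 * p := by linarith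
  induction N with
  | zero => exact ⟨j, by simp, by simp⟩
  | succ N ih =>
    obtain ⟨i, hsub, hle⟩ := ih
    set l := k - ((N + 1 : ℕ) : ℤ) with hl
    have hkl : k - N = l + 1 := by rw [hl]; push_cast; ring
    rw [hkl] at hsub hle
    refine ⟨(i + 1) / 3, hsub.trans (triadic_succ_subset (by omega) (by omega)), le_trans ?_ hle⟩
    rw [pow_succ, mul_assoc]
    refine mul_le_mul_of_nonneg_left ?_ (by positivity)
    generalize ha : (i + 1) / 3 = a
    have hw := triadicWeight_pos (ρ := p / (1 - 2 * p)) (by positivity) a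
    rw [zpow_add_one₀ hq.ne']
    have hfactor (A v : ℝ) : p * (A * v) = A * (1 - 2 * p) * (p / (1 - 2 * p) * v) := by
      rw [mul_assoc, ← mul_assoc (1 - 2 * p), mul_div_cancel₀ _ hq.ne']; ring
    obtain rfl | rfl | rfl : i = 3 * a ∨ i = 3 * a + 1 ∨ i = 3 * a - 1 := by omega
    · rw [triadicWeight_three_mul, mul_comm _ (1 - 2 * p), mul_assoc]
      gcongr
      linarith
    · rw [triadicWeight_three_mul_add_one]
      exact (hfactor _ _).le
    · rw [triadicWeight_three_mul_sub_one]
      exact (hfactor _ _).le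

lemma three_rpow_neg_log_div (hp0 : 0 < p) : (3 : ℝ) ^ (-Real.log p / Real.log 3) = p⁻¹ := by
  have h3 : Real.log 3 ≠ 0 := (Real.log_pos (by norm_num)).ne'
  rw [Real.rpow_def_of_pos (by norm_num), mul_div_cancel₀ _ h3, Real.exp_neg, Real.exp_log hp0]

lemma measure_closedBall_div_le (hp0 : 0 < p) (hp : p ≤ 1 / 3)
    (hμ : ∀ k j, μ (triadic k j) =
      ENNReal.ofReal ((1 - 2 * p) ^ k * triadicWeight (p / (1 - 2 * p)) j))
    {x r R : ℝ} (hr : 0 < r) (hrR : r < R) :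
    μ (closedBall x R) / μ (closedBall x r) ≤ ENNReal.ofReal
      (3 * ((1 - 2 * p) / p) * 9 ^ (-Real.log p / Real.log 3) *
        (R / r) ^ (-Real.log p / Real.log 3)) := by
  have hq : 0 < 1 - 2 * p := by linarith
  have hR : 0 < R := hr.trans hrR
  have hρ : 0 < p / (1 - 2 * p) := by positivity
  have hρ1 : p / (1 - 2 * p) ≤ 1 := by rw [div_le_one hq]; linarith
  have hs : 0 ≤ -Real.log p / Real.log 3 :=
    div_nonneg (neg_nonneg.2 (Real.log_nonpos hp0.le (by linarith))) (Real.log_nonneg (by norm_num))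
  obtain ⟨n, hn, hn'⟩ := exists_mem_Ico_zpow hr (by norm_num : (1 : ℝ) < 3)
  obtain ⟨m, hm, hm'⟩ := exists_mem_Ico_zpow hR (by norm_num : (1 : ℝ) < 3)
  have hnm : n < m + 1 :=
    (zpow_lt_zpow_iff_right₀ (by norm_num : (1 : ℝ) < 3)).1 (hn.trans_lt (hrR.trans hm'))
  obtain ⟨N, hN⟩ : ∃ N : ℕ, m + 1 = n + N := ⟨(m + 1 - n).toNat, by omega⟩
  obtain ⟨j, hj⟩ := exists_mem_triadic (-n) x
  obtain ⟨i, hsub, hle⟩ := exists_triadic_ancestor hp0 hp (-n) j N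
  set l := -n - (N : ℤ) with hl
  set w := triadicWeight (p / (1 - 2 * p)) with hw
  have hwpos := triadicWeight_pos hρ
  have hsmall : ENNReal.ofReal (p ^ N * ((1 - 2 * p) ^ l * w i)) ≤ μ (closedBall x r) := by
    refine (ENNReal.ofReal_le_ofReal hle).trans ?_
    rw [← hμ]
    exact measure_mono (triadic_subset_closedBall hj (by simpa using hn))
  have hbig : μ (closedBall x R) ≤
      ENNReal.ofReal (3 * ((1 - 2 * p) / p) * ((1 - 2 * p) ^ l * w i)) := by
    have hRl : R < (3 : ℝ) ^ (-l) := by rwa [hl, show -(-n - (N : ℤ)) = m + 1 by omega]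
    refine (measure_mono (closedBall_subset_triadic (hsub hj) hRl)).trans ?_
    refine (measure_union_le _ _).trans ((add_le_add_left (measure_union_le _ _) _).trans ?_)
    have hpos (a : ℤ) : 0 ≤ (1 - 2 * p) ^ l * w a := mul_nonneg (by positivity) (hwpos a).le
    rw [hμ, hμ, hμ, ← ENNReal.ofReal_add (hpos _) (hpos _),
      ← ENNReal.ofReal_add (add_nonneg (hpos _) (hpos _)) (hpos _)]
    refine ENNReal.ofReal_le_ofReal ?_
    obtain ⟨h1, h2⟩ := triadicWeight_neighbor hρ hρ1 i
    have h3 : p / (1 - 2 * p) * w i ≤ w i := by nlinarith [hwpos i]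
    have key (a : ℤ) (ha : p / (1 - 2 * p) * w a ≤ w i) :
        (1 - 2 * p) ^ l * w a ≤ (1 - 2 * p) / p * ((1 - 2 * p) ^ l * w i) := by
      rw [mul_left_comm]
      refine mul_le_mul_of_nonneg_left ?_ (by positivity)
      refine le_trans (le_of_eq ?_) (mul_le_mul_of_nonneg_left ha (by positivity))
      field_simp
    linarith [key _ h1, key _ h2, key _ h3]
  have hA : 0 < (1 - 2 * p) ^ l * w i := mul_pos (by positivity) (hwpos i)
  refine (ENNReal.div_le_div hbig hsmall).trans ?_
  rw [← ENNReal.ofReal_div_of_pos (by positivity)]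
  refine ENNReal.ofReal_le_ofReal ?_
  have hpow : p⁻¹ ^ N ≤ (9 * (R / r)) ^ (-Real.log p / Real.log 3) := by
    rw [← three_rpow_neg_log_div hp0, ← Real.rpow_mul_natCast (by norm_num), mul_comm,
      Real.rpow_natCast_mul (by norm_num)]
    refine Real.rpow_le_rpow (by positivity) ?_ hs
    have h3 : (3 : ℝ) ^ (m + 1) = 3 ^ n * 3 ^ N := by
      rw [hN, zpow_add₀ (by norm_num), zpow_natCast]
    rw [zpow_add_one₀ (by norm_num)] at h3 hn'
    rw [← mul_div_assoc, le_div_iff₀ hr]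
    have h4 : (0 : ℝ) < 3 ^ N := by positivity
    nlinarith
  rw [Real.mul_rpow (by norm_num) (by positivity)] at hpow
  calc 3 * ((1 - 2 * p) / p) * ((1 - 2 * p) ^ l * w i) / (p ^ N * ((1 - 2 * p) ^ l * w i))
      = 3 * ((1 - 2 * p) / p) * p⁻¹ ^ N := by
        rw [mul_div_mul_right _ _ hA.ne', inv_pow, ← div_eq_mul_inv]
    _ ≤ _ := by
      rw [mul_assoc (3 * ((1 - 2 * p) / p))]
      exact mul_le_mul_of_nonneg_left hpow (by positivity)

/-- Lower bound for admissible exponents, from the rightmost descendants of `[-1/2, 1/2)`. -/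
lemma le_of_measure_closedBall_div_le (hp0 : 0 < p) (hp1 : p < 1 / 2)
    (hμ : ∀ k j, μ (triadic k j) =
      ENNReal.ofReal ((1 - 2 * p) ^ k * triadicWeight (p / (1 - 2 * p)) j))
    {α C : ℝ} (h : ∀ x r R : ℝ, 0 < r → r < R →
      μ (closedBall x R) / μ (closedBall x r) ≤ ENNReal.ofReal (C * (R / r) ^ α)) :
    -Real.log p / Real.log 3 ≤ α := by
  have hq : 0 < 1 - 2 * p := by linarith
  have hwpos := triadicWeight_pos (ρ := p / (1 - 2 * p)) (by positivity)
  have hj (n : ℕ) : ∃ j, triadic n j ⊆ triadic 0 0 ∧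
      (1 - 2 * p) ^ (n : ℤ) * triadicWeight (p / (1 - 2 * p)) j = p ^ n := by
    induction n with
    | zero => exact ⟨0, by simp, by simp [triadicWeight_zero]⟩
    | succ n ih =>
      obtain ⟨j, hsub, hj⟩ := ih
      refine ⟨3 * j + 1, ?_, ?_⟩
      · rw [Nat.cast_succ]
        exact (triadic_succ_subset (by omega) le_rfl).trans hsub
      · rw [triadicWeight_three_mul_add_one, Nat.cast_succ, zpow_add_one₀ hq.ne', pow_succ, ← hj]
        field_simp
  have hbound (n : ℕ) : (p⁻¹ / 3 ^ α) ^ n ≤ C * 4 ^ α := by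
    obtain ⟨j, hsub, hjn⟩ := hj n
    have h3 : (0 : ℝ) < 3 ^ (-(n : ℤ)) := by positivity
    have hle1 : (3 : ℝ) ^ (-(n : ℤ)) ≤ 1 := zpow_le_one_of_nonpos₀ (by norm_num) (by omega)
    have hx : (j : ℝ) * 3 ^ (-(n : ℤ)) ∈ triadic n j := by
      constructor <;> nlinarith
    have hball : closedBall ((j : ℝ) * 3 ^ (-(n : ℤ))) (3 ^ (-(n : ℤ)) / 4) ⊆ triadic n j := by
      rw [Real.closedBall_eq_Icc]
      rintro y ⟨h1, h2⟩
      constructor <;> nlinarith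
    have hr := h (j * 3 ^ (-(n : ℤ))) (3 ^ (-(n : ℤ)) / 4) 1 (by positivity) (by linarith)
    have hbig : ENNReal.ofReal 1 ≤ μ (closedBall ((j : ℝ) * 3 ^ (-(n : ℤ))) 1) := by
      have := hμ 0 0
      rw [triadicWeight_zero, zpow_zero, mul_one] at this
      rw [← this]
      exact measure_mono (triadic_subset_closedBall (hsub hx) (by simp))
    have hsmall : μ (closedBall ((j : ℝ) * 3 ^ (-(n : ℤ))) (3 ^ (-(n : ℤ)) / 4)) ≤
        ENNReal.ofReal (p ^ n) := by
      rw [← hjn, ← hμ]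
      exact measure_mono hball
    have hle := (ENNReal.div_le_div hbig hsmall).trans hr
    rw [← ENNReal.ofReal_div_of_pos (by positivity)] at hle
    have hle' := (ENNReal.ofReal_le_ofReal_iff' .. ).1 hle
    have hpn : 0 < 1 / p ^ n := by positivity
    have hle'' := hle'.resolve_right (by linarith)
    have he : (1 : ℝ) / (3 ^ (-(n : ℤ)) / 4) = 4 * 3 ^ n := by
      rw [zpow_neg, zpow_natCast]; field_simp
    rw [he, Real.mul_rpow (by norm_num) (by positivity), ← Real.rpow_natCast_mul (by norm_num),
      mul_comm (n : ℝ), Real.rpow_mul_natCast (by norm_num)] at hle''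
    rw [div_pow, div_le_iff₀ (by positivity), inv_pow, ← one_div]
    linarith
  have hle : p⁻¹ / 3 ^ α ≤ 1 := by
    by_contra! hgt
    obtain ⟨n, hn⟩ := pow_unbounded_of_one_lt (C * 4 ^ α) hgt
    exact absurd (hbound n) (not_le.2 hn)
  rw [div_le_one (by positivity), ← three_rpow_neg_log_div hp0] at hle
  exact (Real.rpow_le_rpow_left_iff (by norm_num)).1 hle

end Dimension

/-- **Example (triadic measures on `ℝ`).** For `0 < p < 1/2` there is a Borel measure `μ` on
`ℝ`, fully supported, with `μ([-1/2,1/2)) = 1`, splitting the mass of each triadic interval so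
that the central child gets `1-2p` times and each boundary child `p` times the mass of its
parent. Moreover, if `0 < p ≤ 1/3`, then every such measure satisfies
`dim_A μ = -log p / log 3`. -/
theorem triadic_measure (p : ℝ) (hp0 : 0 < p) (hp1 : p < 1 / 2) :
    (∃ μ : MeasureTheory.Measure ℝ, HasFullSupport μ ∧
      μ (Set.Ico (-(1 / 2) : ℝ) (1 / 2)) = 1 ∧
      ∀ k j : ℤ,
        μ (triadic (k + 1) (3 * j)) = ENNReal.ofReal (1 - 2 * p) * μ (triadic k j) ∧
        μ (triadic (k + 1) (3 * j - 1)) = ENNReal.ofReal p * μ (triadic k j) ∧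
        μ (triadic (k + 1) (3 * j + 1)) = ENNReal.ofReal p * μ (triadic k j)) ∧
    (p ≤ 1 / 3 → ∀ μ : MeasureTheory.Measure ℝ, HasFullSupport μ →
      μ (Set.Ico (-(1 / 2) : ℝ) (1 / 2)) = 1 →
      (∀ k j : ℤ,
        μ (triadic (k + 1) (3 * j)) = ENNReal.ofReal (1 - 2 * p) * μ (triadic k j) ∧
        μ (triadic (k + 1) (3 * j - 1)) = ENNReal.ofReal p * μ (triadic k j) ∧
        μ (triadic (k + 1) (3 * j + 1)) = ENNReal.ofReal p * μ (triadic k j)) →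
      measureAssouadDim μ = ENNReal.ofReal (-Real.log p / Real.log 3)) := by
  have hq : 0 < 1 - 2 * p := by linarith
  have hρ : 0 < p / (1 - 2 * p) := by positivity
  refine ⟨⟨(triadicStieltjes hp0 hp1).measure, ?_, ?_, fun k j => ?_⟩, fun hp μ _ h1 h => ?_⟩
  · refine hasFullSupport_of_triadic fun k j => ?_
    rw [triadicStieltjes_measure_triadic, ENNReal.ofReal_pos]
    exact mul_pos (by positivity) (triadicWeight_pos hρ j)
  · rw [← triadic_zero_zero, triadicStieltjes_measure_triadic]
    simp [triadicWeight_zero]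
  · simp only [triadicStieltjes_measure_triadic, triadicWeight_three_mul,
      triadicWeight_three_mul_add_one, triadicWeight_three_mul_sub_one,
      ← ENNReal.ofReal_mul hq.le, ← ENNReal.ofReal_mul hp0.le, zpow_add_one₀ hq.ne']
    refine ⟨?_, ?_, ?_⟩ <;> congr 1 <;> field_simp
  · have hμ := measure_triadic_eq hp0 hp1 h1 h
    refine le_antisymm (sInf_le ?_) (le_sInf ?_)
    · refine ⟨_, ?_, rfl, 3 * ((1 - 2 * p) / p) * 9 ^ (-Real.log p / Real.log 3), by positivity,
        fun x r R hr hrR => measure_closedBall_div_le hp0 hp hμ hr hrR⟩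
      exact div_nonneg (neg_nonneg.2 (Real.log_nonpos hp0.le (by linarith)))
        (Real.log_nonneg (by norm_num))
    · rintro _ ⟨α, _, rfl, C, _, hC⟩
      exact ENNReal.ofReal_le_ofReal (le_of_measure_closedBall_div_le hp0 hp1 hμ hC)
end

section
/- Let X be a complete metric space containing at least two points with dim_A X < ∞, let 0 < δ < 1/7, and let a δ-adic cube system on X be given with M < ∞. Then lim_{p↓0} dim_L μ_p = 0 in the following sense: for every ε > 0 there exists p_0 > 0 such that for every 0 < p < p_0 and every measure μ_p adapted to p one has dim_L μ_p ≤ ε. -/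
open Metric MeasureTheory Set
open scoped ENNReal

namespace CubeSystem

variable {X : Type*} [MetricSpace X] [MeasurableSpace X] {δ : ℝ}

/-- The number of children of a cube is at most `M`. -/
theorem ncard_children_le (S : CubeSystem X δ) {M : ℕ} (hM : S.maxChildCount = M) {k : ℤ}
    {Q : Set X} (hQ : Q ∈ S.cubes k) : (S.children k Q).ncard ≤ M := by
  have h : (S.children k Q).encard ≤ M :=
    hM ▸ le_iSup_of_le k (le_iSup₂_of_le (f := fun Q _ => S.childCount k Q) Q hQ le_rfl)
  have hfin : (S.children k Q).Finite := Set.finite_of_encard_le_coe h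
  rw [← hfin.cast_ncard_eq] at h
  exact_mod_cast h

/-- Along a sequence of cubes with a common center, an adapted measure decays at most
geometrically, with rate controlled by `1 - (M + 1) * p`. -/
theorem Adapted.pow_mul_le {S : CubeSystem X δ} {p : ℝ} {μ : Measure X}
    (hμ : S.Adapted p μ) (hp : 0 ≤ p) (hδ : 0 < δ) {M : ℕ} (hM : S.maxChildCount = M)
    {x : X} {Q : ℤ → Set X} (hQ : ∀ k, Q k ∈ S.cubes k) (hx : ∀ k, S.center k (Q k) = x)
    (k : ℤ) (n : ℕ) :
    ENNReal.ofReal (1 - (M + 1) * p) ^ n * μ (Q k) ≤ μ (Q (k + n)) := by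
  have hmem : ∀ k, x ∈ Q k := fun k => by
    refine S.ball_subset k (Q k) (hQ k) ?_
    rw [hx k]
    exact Metric.mem_closedBall_self (by positivity)
  induction n with
  | zero => simp
  | succ n ih =>
    set j : ℤ := k + n with hj
    have hchild : Q (j + 1) ∈ S.children j (Q j) :=
      ⟨hQ _, S.nested (by omega) (hQ j) (hQ (j + 1)) ⟨x, hmem _, hmem _⟩⟩
    have hmass := (hμ.2 j (Q j) (hQ j) _ hchild).2 ⟨hchild, by rw [hx, hx]⟩
    have hcard : ((S.children j (Q j)).ncard : ℝ) ≤ M := by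
      exact_mod_cast S.ncard_children_le hM (hQ j)
    have hcoef : 1 - (M + 1) * p ≤ 1 - (((S.children j (Q j)).ncard : ℝ) - 1) * p := by
      nlinarith
    calc ENNReal.ofReal (1 - (M + 1) * p) ^ (n + 1) * μ (Q k)
        = ENNReal.ofReal (1 - (M + 1) * p) *
            (ENNReal.ofReal (1 - (M + 1) * p) ^ n * μ (Q k)) := by ring
      _ ≤ ENNReal.ofReal (1 - (((S.children j (Q j)).ncard : ℝ) - 1) * p) * μ (Q j) := by
          gcongr
      _ = μ (Q (k + (n + 1 : ℕ))) := by
          rw [← hmass, hj]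
          push_cast
          rw [add_assoc]

/-- Around a point which is a center of every generation, the ratio of the adapted measures of
two concentric balls grows at most geometrically in the number of generations. -/
theorem Adapted.measure_div_le {S : CubeSystem X δ} {p : ℝ} {μ : Measure X}
    (hμ : S.Adapted p μ) (hp : 0 ≤ p) (hδ : 0 < δ) {M : ℕ} (hM : S.maxChildCount = M)
    (hpM : 0 < 1 - (M + 1) * p) {x : X} (hx : ∀ k : ℤ, x ∈ S.center k '' S.cubes k)
    (k : ℤ) (n : ℕ) :
    μ (Metric.closedBall x (δ ^ k / 3)) / μ (Metric.closedBall x (2 * δ ^ (k + n))) ≤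
      ENNReal.ofReal (((1 - (M + 1) * p) ^ n)⁻¹) := by
  choose Q hQ hc using hx
  have hR : μ (Metric.closedBall x (δ ^ k / 3)) ≤ μ (Q k) := by
    have := S.ball_subset k (Q k) (hQ k)
    rw [hc k] at this
    exact measure_mono this
  have hr : μ (Q (k + n)) ≤ μ (Metric.closedBall x (2 * δ ^ (k + n))) := by
    have := S.subset_ball (k + n) (Q (k + n)) (hQ (k + n))
    rw [hc] at this
    exact measure_mono this
  have hpow : 0 < (1 - (M + 1) * p) ^ n := by positivity
  refine ENNReal.div_le_of_le_mul ?_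
  rw [ENNReal.ofReal_inv_of_pos hpow, ENNReal.ofReal_pow hpM.le]
  have hne : ENNReal.ofReal (1 - (M + 1) * p) ^ n ≠ 0 :=
    pow_ne_zero _ (by simpa using hpM)
  calc μ (Metric.closedBall x (δ ^ k / 3)) ≤ μ (Q k) := hR
    _ = (ENNReal.ofReal (1 - (M + 1) * p) ^ n)⁻¹ *
          (ENNReal.ofReal (1 - (M + 1) * p) ^ n * μ (Q k)) := by
        rw [← mul_assoc, ENNReal.inv_mul_cancel hne (by finiteness), one_mul]
    _ ≤ _ := by
        gcongr
        exact (hμ.pow_mul_le hp hδ hM hQ hc k n).trans hr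

end CubeSystem

/-- **`dim_L μ_p → 0` as `p ↓ 0`.** Let `X` be a complete metric space with at least two
points and `dim_A X < ∞`, and let `S` be a `δ`-adic cube system on `X` with `M < ∞`. Then for
every `ε > 0` there is `p₀ > 0` such that every measure adapted to some `0 < p < p₀` has
`dim_L μ_p ≤ ε`. -/
theorem tendsto_measureLowerDim_zero (X : Type*) [MetricSpace X] [CompleteSpace X]
    [MeasurableSpace X] [BorelSpace X] [Nontrivial X] (hX : assouadDim X < ⊤)
    (δ : ℝ) (hδ0 : 0 < δ) (hδ1 : δ < 1 / 7) (S : CubeSystem X δ)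
    (M : ℕ) (hM : S.maxChildCount = M) :
    ∀ ε : ℝ, 0 < ε → ∃ p₀ : ℝ, 0 < p₀ ∧ ∀ p : ℝ, 0 < p → p < p₀ →
      ∀ μ : MeasureTheory.Measure X, S.Adapted p μ →
        measureLowerDim μ ≤ ENNReal.ofReal ε := by
  intro ε hε
  have hδ : δ < 1 := by linarith
  have hδε : δ ^ ε < 1 := Real.rpow_lt_one hδ0.le hδ hε
  have hM0 : (0 : ℝ) < M + 1 := by positivity
  refine ⟨(1 - δ ^ ε) / (M + 1), by apply div_pos <;> linarith, ?_⟩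
  intro p hp hp₀ μ hμ
  set q : ℝ := 1 - (M + 1) * p with hq
  have hqε : δ ^ ε < q := by
    rw [lt_div_iff₀ hM0] at hp₀
    linarith
  have hq0 : 0 < q := (Real.rpow_pos_of_pos hδ0 ε).trans hqε
  refine sSup_le ?_
  rintro _ ⟨α, -, rfl, C, hC, hα⟩
  refine ENNReal.ofReal_le_ofReal ?_
  by_contra! hεα
  obtain ⟨x, hx⟩ := S.origin
  obtain ⟨a, b, hab⟩ := exists_pair_ne X
  obtain ⟨k, hk⟩ := exists_pow_lt_of_lt_one (dist_pos.2 hab) hδ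
  have hδk : 0 < δ ^ k := by positivity
  have hdiam : ENNReal.ofReal (δ ^ (k : ℤ) / 3) < Metric.ediam (Set.univ : Set X) := by
    refine lt_of_lt_of_le ?_ (Metric.edist_le_ediam_of_mem (Set.mem_univ a) (Set.mem_univ b))
    rw [edist_dist, ENNReal.ofReal_lt_ofReal_iff (dist_pos.2 hab), zpow_natCast]
    linarith
  have hδα : 0 < δ ^ α := Real.rpow_pos_of_pos hδ0 α
  have hratio : 1 < q / δ ^ α := by
    rw [one_lt_div hδα]
    exact (Real.rpow_lt_rpow_of_exponent_gt hδ0 hδ hεα).trans hqε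
  obtain ⟨n, hn⟩ := pow_unbounded_of_one_lt (C * (1 / 6 : ℝ) ^ α)⁻¹ hratio
  have hn' : (C * (1 / 6 : ℝ) ^ α)⁻¹ < (q / δ ^ α) ^ (n + 1) :=
    hn.trans (pow_lt_pow_right₀ hratio n.lt_succ_self)
  have hδn : 0 < δ ^ (n + 1) := by positivity
  have hsplit : δ ^ ((k : ℤ) + (n + 1 : ℕ)) = δ ^ k * δ ^ (n + 1) := by
    rw [← pow_add]
    exact_mod_cast zpow_natCast δ (k + (n + 1))
  have hrR : 2 * δ ^ ((k : ℤ) + (n + 1 : ℕ)) < δ ^ (k : ℤ) / 3 := by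
    rw [hsplit, zpow_natCast]
    have : δ ^ (n + 1) ≤ δ := pow_le_of_le_one hδ0.le hδ.le n.succ_ne_zero
    nlinarith
  have hbound := (hα x _ _ (by positivity) hrR hdiam).trans
    (hμ.measure_div_le hp.le hδ0 hM hq0 hx k (n + 1))
  rw [ENNReal.ofReal_le_ofReal_iff (by positivity), hsplit, zpow_natCast] at hbound
  have hquot : δ ^ k / 3 / (2 * (δ ^ k * δ ^ (n + 1))) = 1 / 6 * (δ ^ (n + 1))⁻¹ := by
    field_simp
    norm_num
  have hcomm : (δ ^ (n + 1)) ^ α = (δ ^ α) ^ (n + 1) := by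
    rw [← Real.rpow_natCast, ← Real.rpow_natCast, ← Real.rpow_mul hδ0.le,
      ← Real.rpow_mul hδ0.le, mul_comm]
  rw [hquot, Real.mul_rpow (by positivity) (by positivity), Real.inv_rpow hδn.le, hcomm] at hbound
  have hqn : 0 < q ^ (n + 1) := by positivity
  rw [div_pow, inv_lt_iff_one_lt_mul₀ (by positivity)] at hn'
  have hprod := mul_le_mul_of_nonneg_left hbound hqn.le
  rw [mul_inv_cancel₀ hqn.ne'] at hprod
  refine absurd hprod (not_le.2 ?_)
  calc (1 : ℝ) < _ := hn'
    _ = _ := by ring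
end

section
/- Let X be a metric space and let α > dim_A X, and let C < ∞ be a constant such that N(x,R,r) ≤ C (R/r)^α for all x ∈ X and 0 < r < R < ∞. Then there exists a constant K < ∞, depending only on C and α (and not on δ), such that for every 0 < δ < 1/7 and every δ-adic cube system on X, every cube has at most K·δ^{-α} children; in particular M ≤ K·δ^{-α}. -/
open Metric MeasureTheory Set
open scoped ENNReal

namespace CubeSystem

variable {X : Type*} [MetricSpace X] [MeasurableSpace X] {δ : ℝ}

/-- The center of a cube belongs to the cube. -/
lemma center_mem (S : CubeSystem X δ) (hδ : 0 < δ) {k : ℤ} {Q : Set X} (hQ : Q ∈ S.cubes k) :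
    S.center k Q ∈ Q :=
  S.ball_subset k Q hQ (Metric.mem_closedBall_self (by positivity))

/-- Two cubes of the same generation with a common point coincide. -/
lemma eq_of_mem_of_mem (S : CubeSystem X δ) {k : ℤ} {Q Q' : Set X} (hQ : Q ∈ S.cubes k)
    (hQ' : Q' ∈ S.cubes k) {x : X} (hx : x ∈ Q) (hx' : x ∈ Q') : Q = Q' :=
  (S.nested le_rfl hQ' hQ ⟨x, hx', hx⟩).antisymm (S.nested le_rfl hQ hQ' ⟨x, hx, hx'⟩)

/-- Cubes of the same generation `k` with centers at distance at most `δ ^ k / 3` coincide. -/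
lemma eq_of_dist_center_le (S : CubeSystem X δ) (hδ : 0 < δ) {k : ℤ} {Q Q' : Set X}
    (hQ : Q ∈ S.cubes k) (hQ' : Q' ∈ S.cubes k)
    (h : dist (S.center k Q) (S.center k Q') ≤ δ ^ k / 3) : Q = Q' :=
  S.eq_of_mem_of_mem hQ hQ' (S.center_mem hδ hQ) (S.ball_subset k Q' hQ' h)

/-- The children of a cube are at most as many as the balls of a sixth of their scale needed
to cover the outer ball of the cube. -/
lemma childCount_le_coverNumber (S : CubeSystem X δ) (hδ : 0 < δ) {k : ℤ} {Q : Set X}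
    (hQ : Q ∈ S.cubes k) :
    S.childCount k Q ≤ coverNumber (S.center k Q) (2 * δ ^ k) (δ ^ (k + 1) / 6) := by
  refine le_sInf ?_
  rintro _ ⟨s, rfl, hs⟩
  have hcov : ∀ Q' ∈ S.children k Q,
      ∃ y ∈ s, dist (S.center (k + 1) Q') y ≤ δ ^ (k + 1) / 6 := by
    intro Q' hQ'
    simpa using hs (S.subset_ball k Q hQ (hQ'.2 (S.center_mem hδ hQ'.1)))
  have : Nonempty X := ⟨S.center k Q⟩
  choose! f hf_mem hf_dist using hcov
  rw [childCount, ← Set.encard_coe_eq_coe_finsetCard]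
  refine Set.encard_le_encard_of_injOn (f := f) hf_mem fun P hP P' hP' hPP' => ?_
  refine S.eq_of_dist_center_le hδ hP.1 hP'.1 ?_
  have h := hf_dist P' hP'
  rw [← hPP'] at h
  linarith [dist_triangle_right (S.center (k + 1) P) (S.center (k + 1) P') (f P), hf_dist P hP]

end CubeSystem

/-- **Bound on the number of children.** Let `X` be a metric space, `α > dim_A X` and `C < ∞`
with `N(x,R,r) ≤ C (R/r)^α` for all `x` and `0 < r < R`. Then there is a constant `K`,
depending only on `C` and `α` (not on `δ`), such that for every `0 < δ < 1/7` and every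
`δ`-adic cube system on `X`, every cube has at most `K δ^{-α}` children; in particular
`M ≤ K δ^{-α}`. -/
theorem childCount_le_of_assouad_bound (X : Type*) [MetricSpace X]
    [MeasurableSpace X] [BorelSpace X]
    (α C : ℝ) (hα : assouadDim X < ENNReal.ofReal α)
    (hC : ∀ x : X, ∀ r R : ℝ, 0 < r → r < R →
      (coverNumber x R r : ℝ≥0∞) ≤ ENNReal.ofReal (C * (R / r) ^ α)) :
    ∃ K : ℝ, 0 < K ∧ ∀ δ : ℝ, 0 < δ → δ < 1 / 7 → ∀ S : CubeSystem X δ,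
      (∀ k : ℤ, ∀ Q ∈ S.cubes k,
        (S.childCount k Q : ℝ≥0∞) ≤ ENNReal.ofReal (K * δ ^ (-α))) ∧
      (S.maxChildCount : ℝ≥0∞) ≤ ENNReal.ofReal (K * δ ^ (-α)) := by
  refine ⟨(|C| + 1) * 12 ^ α, by positivity, fun δ hδ hδ7 S => ?_⟩
  have hchild : ∀ k : ℤ, ∀ Q ∈ S.cubes k,
      (S.childCount k Q : ℝ≥0∞) ≤ ENNReal.ofReal ((|C| + 1) * 12 ^ α * δ ^ (-α)) := by
    intro k Q hQ
    have hk : 0 < δ ^ k := by positivity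
    have hk1 : δ ^ (k + 1) = δ ^ k * δ := zpow_add_one₀ hδ.ne' k
    have hratio : 2 * δ ^ k / (δ ^ (k + 1) / 6) = 12 * δ⁻¹ := by
      rw [hk1]
      field_simp
      norm_num
    have hlt : δ ^ (k + 1) / 6 < 2 * δ ^ k := by
      rw [hk1]
      nlinarith
    refine (ENat.toENNReal_le.2 (S.childCount_le_coverNumber hδ hQ)).trans
      ((hC _ _ _ (by positivity) hlt).trans (ENNReal.ofReal_le_ofReal ?_))
    rw [hratio, Real.mul_rpow (by norm_num) (by positivity), Real.inv_rpow hδ.le,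
      ← Real.rpow_neg hδ.le, ← mul_assoc]
    gcongr
    linarith [le_abs_self C]
  exact ⟨hchild, ENat.le_floor.1 <| iSup_le fun k => iSup₂_le fun Q hQ =>
    ENat.le_floor.2 (hchild k Q hQ)⟩
end
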